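/- Let l : 2^V → ℝ be submodular with l(∅) = 0, let s ∈ ℝ^p have all coordinates nonnegative, let π be a permutation of {1,…,p} with s_{π_1} ≥ s_{π_2} ≥ … ≥ s_{π_p}, and define μ ∈ ℝ^p by μ_{π_j} = l({π_1,…,π_j}) − l({π_1,…,π_{j−1}}) for j = 1,…,p. Then μ lies in the base polyhedron B(l), and for every x ∈ B(l) one has ⟨s, x⟩ ≤ ⟨s, μ⟩ = ℓ̂(s); that is, the greedy vector μ maximizes ⟨s, ·⟩ over B(l) with optimal value the Lovász extension ℓ̂(s). -/

import Mathlib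

open Finset

/-- The chain {σ₁,…,σⱼ}: the image under σ of the first j indices. -/
def chainSet {p : ℕ} (σ : Equiv.Perm (Fin p)) (j : ℕ) : Finset (Fin p) :=
  (Finset.univ.filter fun k : Fin p => (k : ℕ) < j).image σ

/-- G_l(σ, s) = Σ_{j=1}^p s_{σ_j}·(l({σ₁,…,σⱼ}) − l({σ₁,…,σ_{j−1}})). -/
def lovaszSum {p : ℕ} (l : Finset (Fin p) → ℝ) (σ : Equiv.Perm (Fin p))
    (s : Fin p → ℝ) : ℝ :=
  ∑ j : Fin p, s (σ j) * (l (chainSet σ ((j : ℕ) + 1)) - l (chainSet σ (j : ℕ)))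

/-- Indicator vector 1_A ∈ {0,1}^p of A ⊆ V. -/
def indic {p : ℕ} (A : Finset (Fin p)) : Fin p → ℝ := fun i => if i ∈ A then 1 else 0

/-- A permutation sorting s in decreasing order: s_{π_1} ≥ … ≥ s_{π_p}. -/
def SortsDesc {p : ℕ} (π : Equiv.Perm (Fin p)) (s : Fin p → ℝ) : Prop :=
  ∀ j k : Fin p, j ≤ k → s (π k) ≤ s (π j)

/-- A canonical permutation sorting s in decreasing order. -/
noncomputable def sortDesc {p : ℕ} (s : Fin p → ℝ) : Equiv.Perm (Fin p) :=
  Tuple.sort (fun i => -s i)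

/-- The Lovász extension ℓ̂(s) = G_l(π, s) for a permutation π sorting s
decreasingly (independent of the choice of such π). -/
noncomputable def lovaszExt {p : ℕ} (l : Finset (Fin p) → ℝ) (s : Fin p → ℝ) : ℝ :=
  lovaszSum l (sortDesc s) s

/-- Submodularity: l(A) + l(B) ≥ l(A ∪ B) + l(A ∩ B). -/
def Submodular {p : ℕ} (l : Finset (Fin p) → ℝ) : Prop :=
  ∀ A B : Finset (Fin p), l (A ∪ B) + l (A ∩ B) ≤ l A + l B

/-- The slack-rescaling surrogate S_l(s) = max_{I⊆V} l(I)·(1 − 2 Σ_{i∈I}(1 − s_i)). -/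
noncomputable def slackSur {p : ℕ} (l : Finset (Fin p) → ℝ) (s : Fin p → ℝ) : ℝ :=
  Finset.univ.sup' Finset.univ_nonempty
    (fun I : Finset (Fin p) => l I * (1 - 2 * ∑ i ∈ I, (1 - s i)))

/-- The margin-rescaling surrogate M_l(s) = max_{I⊆V} ( l(I) − 2 Σ_{i∈I}(1 − s_i) ). -/
noncomputable def marginSur {p : ℕ} (l : Finset (Fin p) → ℝ) (s : Fin p → ℝ) : ℝ :=
  Finset.univ.sup' Finset.univ_nonempty
    (fun I : Finset (Fin p) => l I - 2 * ∑ i ∈ I, (1 - s i))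

/-- The Lovász hinge, general (non-monotonic) case. -/
noncomputable def hingeGen {p : ℕ} (l : Finset (Fin p) → ℝ) (s : Fin p → ℝ) : ℝ :=
  Finset.univ.sup' Finset.univ_nonempty
    (fun σ : Equiv.Perm (Fin p) => max 0 (lovaszSum l σ s))

/-- The Lovász hinge, increasing case (componentwise thresholding). -/
noncomputable def hingeInc {p : ℕ} (l : Finset (Fin p) → ℝ) (s : Fin p → ℝ) : ℝ :=
  Finset.univ.sup' Finset.univ_nonempty
    (fun σ : Equiv.Perm (Fin p) =>
      ∑ j : Fin p, max (s (σ j)) 0 *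
        (l (chainSet σ ((j : ℕ) + 1)) - l (chainSet σ (j : ℕ))))

theorem chainSet_zero {p : ℕ} (σ : Equiv.Perm (Fin p)) : chainSet σ 0 = ∅ := by
  simp [chainSet]

theorem chainSet_last {p : ℕ} (σ : Equiv.Perm (Fin p)) : chainSet σ p = Finset.univ := by
  ext i
  simp [chainSet]

theorem apply_notMem_chainSet {p : ℕ} (σ : Equiv.Perm (Fin p)) (j : Fin p) :
    σ j ∉ chainSet σ (j : ℕ) := by
  simp [chainSet]

theorem chainSet_succ {p : ℕ} (σ : Equiv.Perm (Fin p)) (j : Fin p) :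
    chainSet σ ((j : ℕ) + 1) = insert (σ j) (chainSet σ (j : ℕ)) := by
  have h : (Finset.univ.filter fun k : Fin p => (k : ℕ) < (j : ℕ) + 1) =
      insert j (Finset.univ.filter fun k : Fin p => (k : ℕ) < (j : ℕ)) := by
    ext k
    simp only [Finset.mem_filter, Finset.mem_univ, true_and, Finset.mem_insert, Fin.ext_iff]
    omega
  rw [chainSet, h, Finset.image_insert, chainSet]

theorem sum_chainSet_succ {p : ℕ} (σ : Equiv.Perm (Fin p)) (f : Fin p → ℝ) (j : Fin p) :
    ∑ i ∈ chainSet σ ((j : ℕ) + 1), f i = f (σ j) + ∑ i ∈ chainSet σ (j : ℕ), f i := by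
  rw [chainSet_succ, Finset.sum_insert (apply_notMem_chainSet σ j)]

/-- The greedy vector is tight on every member of the chain. -/
theorem sum_chainSet_greedy {p : ℕ} {l : Finset (Fin p) → ℝ} (h0 : l ∅ = 0)
    {σ : Equiv.Perm (Fin p)} {μ : Fin p → ℝ}
    (hμ : ∀ j : Fin p, μ (σ j) = l (chainSet σ ((j : ℕ) + 1)) - l (chainSet σ (j : ℕ)))
    {j : ℕ} (hj : j ≤ p) : ∑ i ∈ chainSet σ j, μ i = l (chainSet σ j) := by
  induction j with
  | zero => simp [chainSet_zero, h0]
  | succ j ih =>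
    have h := sum_chainSet_succ σ μ ⟨j, hj⟩
    have hm := hμ ⟨j, hj⟩
    have hi := ih (by omega)
    dsimp only at h hm
    linarith

theorem sum_inter_chainSet_greedy_le {p : ℕ} {l : Finset (Fin p) → ℝ} (hsub : Submodular l)
    (h0 : l ∅ = 0) {σ : Equiv.Perm (Fin p)} {μ : Fin p → ℝ}
    (hμ : ∀ j : Fin p, μ (σ j) = l (chainSet σ ((j : ℕ) + 1)) - l (chainSet σ (j : ℕ)))
    (A : Finset (Fin p)) {j : ℕ} (hj : j ≤ p) :
    ∑ i ∈ A ∩ chainSet σ j, μ i ≤ l (A ∩ chainSet σ j) := by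
  induction j with
  | zero => simp [chainSet_zero, h0]
  | succ j ih =>
    have hi := ih (by omega)
    have hC := chainSet_succ σ ⟨j, hj⟩
    have hn := apply_notMem_chainSet σ ⟨j, hj⟩
    have hm := hμ ⟨j, hj⟩
    dsimp only at hC hn hm
    rw [hC] at hm ⊢
    by_cases hA : σ ⟨j, hj⟩ ∈ A
    · rw [Finset.inter_insert_of_mem hA, Finset.sum_insert (by simp [hn])]
      have hS := hsub (insert (σ ⟨j, hj⟩) (A ∩ chainSet σ j)) (chainSet σ j)
      rw [Finset.insert_union, Finset.union_eq_right.2 Finset.inter_subset_right,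
        Finset.insert_inter_of_notMem hn, Finset.inter_assoc, Finset.inter_self] at hS
      linarith
    · rwa [Finset.inter_insert_of_notMem hA]

/-- Abel summation along the chain of a decreasing rearrangement. -/
theorem mul_sum_chainSet_le {p : ℕ} {s : Fin p → ℝ} {σ : Equiv.Perm (Fin p)}
    (hσ : SortsDesc σ s) {d : Fin p → ℝ}
    (hd : ∀ j ≤ p, 0 ≤ ∑ i ∈ chainSet σ j, d i) {j : ℕ} (hj : j ≤ p) {t : ℝ}
    (ht : ∀ k : Fin p, (k : ℕ) < j → t ≤ s (σ k)) :
    t * ∑ i ∈ chainSet σ j, d i ≤ ∑ i ∈ chainSet σ j, s i * d i := by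
  induction j generalizing t with
  | zero => simp [chainSet_zero]
  | succ j ih =>
    have hi := ih (by omega) (t := s (σ ⟨j, hj⟩)) fun k hk => hσ k ⟨j, hj⟩ hk.le
    have hsum := sum_chainSet_succ σ d ⟨j, hj⟩
    have hsum' := sum_chainSet_succ σ (fun i => s i * d i) ⟨j, hj⟩
    dsimp only at hsum hsum'
    calc t * ∑ i ∈ chainSet σ (j + 1), d i
        ≤ s (σ ⟨j, hj⟩) * ∑ i ∈ chainSet σ (j + 1), d i :=
          mul_le_mul_of_nonneg_right (ht ⟨j, hj⟩ (Nat.lt_succ_self j)) (hd _ hj)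
      _ ≤ ∑ i ∈ chainSet σ (j + 1), s i * d i := by
          rw [hsum, hsum', mul_add]
          linarith

/-- the greedy vector μ lies in the base polyhedron B(l) and
maximizes ⟨s,·⟩ over B(l), with optimal value the Lovász extension G_l(π,s). -/
theorem greedy_maximizes_over_base_polyhedron (p : ℕ) (hp : 1 ≤ p)
    (l : Finset (Fin p) → ℝ) (hsub : Submodular l) (h0 : l ∅ = 0)
    (s : Fin p → ℝ) (hs : ∀ i, 0 ≤ s i)
    (π : Equiv.Perm (Fin p)) (hπ : SortsDesc π s)
    (μ : Fin p → ℝ)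
    (hμ : ∀ j : Fin p, μ (π j) = l (chainSet π ((j : ℕ) + 1)) - l (chainSet π (j : ℕ))) :
    ((∀ A : Finset (Fin p), ∑ i ∈ A, μ i ≤ l A) ∧
        ∑ i : Fin p, μ i = l Finset.univ) ∧
      (∀ x : Fin p → ℝ,
          (∀ A : Finset (Fin p), ∑ i ∈ A, x i ≤ l A) →
          (∑ i : Fin p, x i = l Finset.univ) →
          ∑ i : Fin p, s i * x i ≤ ∑ i : Fin p, s i * μ i) ∧
      ∑ i : Fin p, s i * μ i = lovaszSum l π s := by
  refine ⟨⟨fun A => ?_, ?_⟩, fun x hx _ => ?_, ?_⟩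
  · simpa [chainSet_last] using sum_inter_chainSet_greedy_le hsub h0 hμ A le_rfl
  · simpa [chainSet_last] using sum_chainSet_greedy h0 hμ le_rfl
  · have h := mul_sum_chainSet_le hπ (d := fun i => μ i - x i) (t := 0)
      (fun j hj => by
        rw [Finset.sum_sub_distrib, sum_chainSet_greedy h0 hμ hj]
        exact sub_nonneg.2 (hx _)) le_rfl fun k _ => hs _
    simpa [chainSet_last, mul_sub, Finset.sum_sub_distrib] using h
  · rw [lovaszSum, ← Equiv.sum_comp π]
    exact Finset.sum_congr rfl fun j _ => by rw [hμ]
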